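/- arXiv:1807.06888 — 5 statements merged into one kernel-verified Lean document; each statement's English description precedes it below -/
import Mathlib

section
/- Fix a polynomial initial value problem over variables S = {x_1,…,x_n}, a partition G of S, and a real number ε ≥ 0. Then there exists a unique coarsest ε-BDE partition of S refining G; that is, there exists an ε-BDE partition H refining G such that every ε-BDE partition of S refining G refines H. -/
open MvPolynomial

noncomputable section

/-- The sum of the absolute values of the coefficients of a multivariate polynomial
(in normal form, where each monomial appears at most once). -/
def coeffAbsSum {σ : Type*} (p : MvPolynomial σ ℝ) : ℝ :=
  ∑ α ∈ p.support, |coeff α p|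

/-- The representative variable of the block of `i` in the partition `s`. -/
def ptrep {n : ℕ} (s : Setoid (Fin n)) (i : Fin n) : Fin n :=
  (Quotient.mk s i).out

/-- `x_i ∼^B_{H,ε} x_j` : the coefficients of the substituted difference polynomial
`π_H (q_i - q_j)` sum up, in absolute value, to at most `ε`. -/
def simB {n : ℕ} (q : Fin n → MvPolynomial (Fin n) ℝ) (s : Setoid (Fin n)) (ε : ℝ)
    (i j : Fin n) : Prop :=
  coeffAbsSum (rename (ptrep s) (q i - q j)) ≤ ε

/-- `s` refines `t` : every block of `s` is contained in some block of `t`. -/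
def Refines {n : ℕ} (s t : Setoid (Fin n)) : Prop :=
  ∀ i j : Fin n, s.r i j → t.r i j

/-- `s` is an `ε`-BDE partition : `s = S / (∼^{B*}_{s,ε} ∩ ∼_s)`, where `∼^{B*}_{s,ε}` is the
transitive closure of `∼^B_{s,ε}` and `∼_s` is the equivalence relation induced by `s`. -/
def IsEpsBDE {n : ℕ} (q : Fin n → MvPolynomial (Fin n) ℝ) (s : Setoid (Fin n)) (ε : ℝ) : Prop :=
  ∀ i j : Fin n, s.r i j ↔ (Relation.TransGen (simB q s ε) i j ∧ s.r i j)

theorem coeffAbsSum_eq_sum_of_subset {σ : Type*} {p : MvPolynomial σ ℝ} {s : Finset (σ →₀ ℕ)}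
    (h : p.support ⊆ s) : coeffAbsSum p = ∑ α ∈ s, |coeff α p| := by
  refine Finset.sum_subset h fun α _ hα => ?_
  rw [notMem_support_iff.mp hα, abs_zero]

theorem coeffAbsSum_zero {σ : Type*} : coeffAbsSum (0 : MvPolynomial σ ℝ) = 0 := by
  simp [coeffAbsSum]

theorem coeffAbsSum_neg {σ : Type*} (p : MvPolynomial σ ℝ) :
    coeffAbsSum (-p) = coeffAbsSum p := by
  simp [coeffAbsSum]

theorem coeffAbsSum_add_le {σ : Type*} (p r : MvPolynomial σ ℝ) :
    coeffAbsSum (p + r) ≤ coeffAbsSum p + coeffAbsSum r := by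
  classical
  rw [coeffAbsSum_eq_sum_of_subset (support_add (p := p) (q := r)),
    coeffAbsSum_eq_sum_of_subset (p := p) (Finset.subset_union_left (s₂ := r.support)),
    coeffAbsSum_eq_sum_of_subset (p := r) (Finset.subset_union_right (s₁ := p.support)),
    ← Finset.sum_add_distrib]
  refine Finset.sum_le_sum fun α _ => ?_
  rw [coeff_add]
  exact abs_add_le _ _

theorem coeffAbsSum_monomial {σ : Type*} (m : σ →₀ ℕ) (a : ℝ) :
    coeffAbsSum (monomial m a) = |a| := by
  classical
  rw [coeffAbsSum_eq_sum_of_subset support_monomial_subset]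
  simp

theorem coeffAbsSum_rename_le {σ τ : Type*} (f : σ → τ) (p : MvPolynomial σ ℝ) :
    coeffAbsSum (rename f p) ≤ coeffAbsSum p := by
  conv_lhs => rw [p.as_sum, map_sum]
  refine (Finset.le_sum_of_subadditive coeffAbsSum coeffAbsSum_zero.le
    coeffAbsSum_add_le _ _).trans ?_
  simp only [rename_monomial, coeffAbsSum_monomial]
  exact le_rfl

theorem ptrep_comp_ptrep {n : ℕ} {s t : Setoid (Fin n)} (h : s ≤ t) :
    ptrep t ∘ ptrep s = ptrep t :=
  funext fun i => congrArg Quotient.out (Quotient.sound (h (Quotient.mk_out (s := s) i)))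

theorem simB_mono {n : ℕ} (q : Fin n → MvPolynomial (Fin n) ℝ) {s t : Setoid (Fin n)}
    (h : s ≤ t) {ε : ℝ} {i j : Fin n} (hij : simB q s ε i j) : simB q t ε i j := by
  unfold simB at *
  rw [← ptrep_comp_ptrep h, ← rename_rename]
  exact (coeffAbsSum_rename_le _ _).trans hij

theorem simB_refl {n : ℕ} (q : Fin n → MvPolynomial (Fin n) ℝ) (s : Setoid (Fin n)) {ε : ℝ}
    (hε : 0 ≤ ε) (i : Fin n) : simB q s ε i i := by
  simpa [simB, coeffAbsSum_zero] using hε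

theorem simB_symm {n : ℕ} (q : Fin n → MvPolynomial (Fin n) ℝ) (s : Setoid (Fin n)) (ε : ℝ) :
    Std.Symm (simB q s ε) := ⟨fun i j h => by
  unfold simB at *
  rwa [← neg_sub, map_neg, coeffAbsSum_neg]⟩

/-- The equivalence relation given by the transitive closure of `simB`. -/
def simBSetoid {n : ℕ} (q : Fin n → MvPolynomial (Fin n) ℝ) (s : Setoid (Fin n)) {ε : ℝ}
    (hε : 0 ≤ ε) : Setoid (Fin n) where
  r := Relation.TransGen (simB q s ε)
  iseqv := ⟨fun i => .single (simB_refl q s hε i),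
    fun h => have := simB_symm q s ε; Relation.TransGen.stdSymm.symm _ _ h, fun h h' => h.trans h'⟩

theorem isEpsBDE_iff_le {n : ℕ} (q : Fin n → MvPolynomial (Fin n) ℝ) (s : Setoid (Fin n)) {ε : ℝ}
    (hε : 0 ≤ ε) : IsEpsBDE q s ε ↔ s ≤ simBSetoid q s hε :=
  ⟨fun h i j hij => ((h i j).1 hij).1, fun h _ _ => ⟨fun hij => ⟨h hij, hij⟩, And.right⟩⟩

theorem isEpsBDE_sSup {n : ℕ} (q : Fin n → MvPolynomial (Fin n) ℝ) {ε : ℝ} (hε : 0 ≤ ε)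
    {A : Set (Setoid (Fin n))} (hA : ∀ s ∈ A, IsEpsBDE q s ε) : IsEpsBDE q (sSup A) ε := by
  refine (isEpsBDE_iff_le q _ hε).2 (sSup_le fun s hs i j hij => ?_)
  exact Relation.TransGen.mono (fun _ _ => simB_mono q (le_sSup hs)) _ _ ((hA s hs i j).1 hij).1

/-- for any PIVP (polynomials `q` with initial condition `σ0`), any partition
`G` of the variables and any `ε ≥ 0`, there is a unique coarsest `ε`-BDE partition refining
`G`, i.e. an `ε`-BDE partition `H` refining `G` which is refined by every `ε`-BDE partition
refining `G`. -/
theorem exists_unique_coarsest_epsBDE {n : ℕ} (q : Fin n → MvPolynomial (Fin n) ℝ)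
    (σ0 : Fin n → ℝ) (G : Setoid (Fin n)) (ε : ℝ) (hε : 0 ≤ ε) :
    ∃! H : Setoid (Fin n), IsEpsBDE q H ε ∧ Refines H G ∧
      ∀ H' : Setoid (Fin n), IsEpsBDE q H' ε → Refines H' G → Refines H' H := by
  set A : Set (Setoid (Fin n)) := {H' | IsEpsBDE q H' ε ∧ Refines H' G}
  have hH : IsEpsBDE q (sSup A) ε := isEpsBDE_sSup q hε fun _ hs => hs.1
  have hG : sSup A ≤ G := sSup_le fun _ hs i j hij => hs.2 i j hij
  have hmax : ∀ H', IsEpsBDE q H' ε → Refines H' G → H' ≤ sSup A :=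
    fun _ h h' => le_sSup ⟨h, h'⟩
  refine ⟨sSup A, ⟨hH, fun _ _ hij => hG hij, fun H' h h' _ _ hij => hmax H' h h' hij⟩, ?_⟩
  rintro H ⟨h, h', hcoarse⟩
  exact le_antisymm (hmax H h h') fun i j hij =>
    hcoarse _ hH (fun _ _ hij => hG hij) i j hij
end
end

section
/- Fix a polynomial initial value problem over variables S = {x_1,…,x_n}, a partition G of S, and ε ≥ 0. Define the refinement operator F on partitions of S by F(H) = S/(∼^{F*}_{H,ε} ∩ ∼_H). Then for the iteration H_0 = G, H_{k+1} = F(H_k): each H_{k+1} refines H_k; the sequence stabilizes after at most n iterations, i.e., there exists k ≤ n with F(H_k) = H_k; and the first such fixed point H_k is the unique coarsest ε-FDE partition of S refining G. -/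
open MvPolynomial

noncomputable section

/-- A polynomial over the variables `S`, viewed as a polynomial over `S ∪ {s}`, where the
fresh variable `s` is encoded as `none`. -/
def liftP {n : ℕ} (p : MvPolynomial (Fin n) ℝ) : MvPolynomial (Option (Fin n)) ℝ :=
  rename some p

/-- The substitution `x_i ↦ s (x_i + x_j)`, `x_j ↦ (1 - s) (x_i + x_j)`, with the fresh
variable `s` encoded as `none`. -/
def fdeSubst {n : ℕ} (i j : Fin n) : Option (Fin n) → MvPolynomial (Option (Fin n)) ℝ :=
  fun v =>
    if v = some i then X none * (X (some i) + X (some j))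
    else if v = some j then (1 - X none) * (X (some i) + X (some j))
    else X v

open Classical in
/-- The polynomial `p^{H_k}_{i,j} = Σ_{x_l ∈ H_k} q_l − Σ_{x_l ∈ H_k} q_l[x_i ↦ s(x_i+x_j),
x_j ↦ (1−s)(x_i+x_j)]` over the variables `S ∪ {s}`, where `H_k` is the block of `k` in the
partition `s`. -/
def blockDiff {n : ℕ} (q : Fin n → MvPolynomial (Fin n) ℝ) (s : Setoid (Fin n))
    (k i j : Fin n) : MvPolynomial (Option (Fin n)) ℝ :=
  (∑ l ∈ Finset.univ.filter fun l => s.r l k, liftP (q l)) -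
    ∑ l ∈ Finset.univ.filter fun l => s.r l k, aeval (fdeSubst i j) (liftP (q l))

open Classical in
/-- `Σ_{k=1}^m` (sum of the absolute values of the coefficients of `p^{H_k}_{i,j}` in normal
form), the sum ranging over all blocks of the partition `s` (every block is represented
exactly once, by its representative). -/
def fdeSum {n : ℕ} (q : Fin n → MvPolynomial (Fin n) ℝ) (s : Setoid (Fin n))
    (i j : Fin n) : ℝ :=
  ∑ k ∈ Finset.univ.filter fun k => ptrep s k = k, coeffAbsSum (blockDiff q s k i j)

/-- `x_i ∼^F_{H,ε} x_j`. -/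
def simF {n : ℕ} (q : Fin n → MvPolynomial (Fin n) ℝ) (s : Setoid (Fin n)) (ε : ℝ)
    (i j : Fin n) : Prop :=
  fdeSum q s i j ≤ ε

/-- `s` is an `ε`-FDE partition : `s = S / (∼^{F*}_{s,ε} ∩ ∼_s)`, where `∼^{F*}_{s,ε}` is the
(equivalence) closure of `∼^F_{s,ε}` and `∼_s` is the equivalence relation induced by `s`. -/
def IsEpsFDE {n : ℕ} (q : Fin n → MvPolynomial (Fin n) ℝ) (s : Setoid (Fin n)) (ε : ℝ) : Prop :=
  ∀ i j : Fin n, s.r i j ↔ (Relation.EqvGen (simF q s ε) i j ∧ s.r i j)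

/-- The refinement operator `F(H) = S / (∼^{F*}_{H,ε} ∩ ∼_H)`. -/
def refineF {n : ℕ} (q : Fin n → MvPolynomial (Fin n) ℝ) (ε : ℝ)
    (H : Setoid (Fin n)) : Setoid (Fin n) where
  r i j := Relation.EqvGen (simF q H ε) i j ∧ H.r i j
  iseqv := by
    refine ⟨fun i => ⟨Relation.EqvGen.refl i, H.iseqv.refl i⟩, ?_, ?_⟩
    · rintro i j ⟨h1, h2⟩
      exact ⟨Relation.EqvGen.symm _ _ h1, H.iseqv.symm h2⟩
    · rintro i j k ⟨h1, h2⟩ ⟨h3, h4⟩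
      exact ⟨Relation.EqvGen.trans _ _ _ h1 h3, H.iseqv.trans h2 h4⟩

theorem coeffAbsSum_eq_sum_of_support_subset {σ : Type*} (p : MvPolynomial σ ℝ)
    {t : Finset (σ →₀ ℕ)} (h : p.support ⊆ t) : coeffAbsSum p = ∑ α ∈ t, |coeff α p| := by
  refine Finset.sum_subset h fun α _ hα => ?_
  rw [notMem_support_iff.mp hα, abs_zero]

theorem coeffAbsSum_sum_le {σ ι : Type*} (t : Finset ι) (f : ι → MvPolynomial σ ℝ) :
    coeffAbsSum (∑ a ∈ t, f a) ≤ ∑ a ∈ t, coeffAbsSum (f a) :=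
  Finset.le_sum_of_subadditive _ coeffAbsSum_zero.le coeffAbsSum_add_le t f

theorem ptrep_rel {n : ℕ} (s : Setoid (Fin n)) (i : Fin n) : s.r (ptrep s i) i :=
  Quotient.exact (Quotient.out_eq (Quotient.mk s i))

theorem ptrep_eq_of_rel {n : ℕ} (s : Setoid (Fin n)) {i j : Fin n} (h : s.r i j) :
    ptrep s i = ptrep s j :=
  congrArg Quotient.out (Quotient.sound h)

theorem ptrep_ptrep {n : ℕ} (s : Setoid (Fin n)) (i : Fin n) :
    ptrep s (ptrep s i) = ptrep s i :=
  ptrep_eq_of_rel s (ptrep_rel s i)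

theorem rel_iff_ptrep_eq {n : ℕ} (s : Setoid (Fin n)) {k : Fin n} (hk : ptrep s k = k)
    (l : Fin n) : s.r l k ↔ ptrep s l = k :=
  ⟨fun h => (ptrep_eq_of_rel s h).trans hk,
    fun h => h ▸ s.iseqv.symm (ptrep_rel s l)⟩

theorem Refines.antisymm {n : ℕ} {s t : Setoid (Fin n)} (hst : Refines s t)
    (hts : Refines t s) : s = t :=
  Setoid.ext fun i j => ⟨hst i j, hts i j⟩

/-- The contribution of `q_l` to the polynomials `blockDiff`. -/
def varDiff {n : ℕ} (q : Fin n → MvPolynomial (Fin n) ℝ) (i j l : Fin n) :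
    MvPolynomial (Option (Fin n)) ℝ :=
  liftP (q l) - aeval (fdeSubst i j) (liftP (q l))

open Classical in
theorem blockDiff_eq_sum_varDiff {n : ℕ} (q : Fin n → MvPolynomial (Fin n) ℝ)
    (s : Setoid (Fin n)) {k : Fin n} (hk : ptrep s k = k) (i j : Fin n) :
    blockDiff q s k i j = ∑ l ∈ Finset.univ.filter (fun l => ptrep s l = k), varDiff q i j l := by
  simp only [blockDiff, varDiff, Finset.sum_sub_distrib, rel_iff_ptrep_eq s hk]

open Classical in
/-- A block of a partition is the union of the blocks of a refinement which it contains. -/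
theorem blockDiff_eq_sum_blockDiff {n : ℕ} (q : Fin n → MvPolynomial (Fin n) ℝ)
    {s t : Setoid (Fin n)} (h : Refines s t) {k : Fin n} (hk : ptrep t k = k) (i j : Fin n) :
    blockDiff q t k i j =
      ∑ m ∈ (Finset.univ.filter fun m => ptrep s m = m).filter (fun m => ptrep t m = k),
        blockDiff q s m i j := by
  rw [blockDiff_eq_sum_varDiff q t hk]
  have hrep (l : Fin n) : ptrep t (ptrep s l) = ptrep t l :=
    ptrep_eq_of_rel t (h _ _ (ptrep_rel s l))
  rw [← Finset.sum_fiberwise_of_maps_to (g := ptrep s)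
    (t := (Finset.univ.filter fun m => ptrep s m = m).filter (fun m => ptrep t m = k))]
  · refine Finset.sum_congr rfl fun m hm => ?_
    simp only [Finset.mem_filter, Finset.mem_univ, true_and] at hm
    rw [blockDiff_eq_sum_varDiff q s hm.1, Finset.filter_filter]
    refine Finset.sum_congr (Finset.filter_congr fun l _ => ?_) fun _ _ => rfl
    refine ⟨fun hl => hl.2, fun hl => ⟨?_, hl⟩⟩
    rw [← hrep, hl, hm.2]
  · intro l hl
    simp only [Finset.mem_filter, Finset.mem_univ, true_and] at hl ⊢
    exact ⟨ptrep_ptrep s l, (hrep l).trans hl⟩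

theorem fdeSum_le_of_refines {n : ℕ} (q : Fin n → MvPolynomial (Fin n) ℝ)
    {s t : Setoid (Fin n)} (h : Refines s t) (i j : Fin n) :
    fdeSum q t i j ≤ fdeSum q s i j := by
  classical
  unfold fdeSum
  rw [← Finset.sum_fiberwise_of_maps_to (g := ptrep t)
    (s := Finset.univ.filter fun m => ptrep s m = m)
    (t := Finset.univ.filter fun k => ptrep t k = k)]
  · refine Finset.sum_le_sum fun k hk => ?_
    rw [blockDiff_eq_sum_blockDiff q h (Finset.mem_filter.mp hk).2]
    exact coeffAbsSum_sum_le _ _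
  · intro m _
    simpa using ptrep_ptrep t m

theorem refineF_refines {n : ℕ} (q : Fin n → MvPolynomial (Fin n) ℝ) (ε : ℝ)
    (H : Setoid (Fin n)) : Refines (refineF q ε H) H :=
  fun _ _ h => h.2

theorem refineF_mono {n : ℕ} (q : Fin n → MvPolynomial (Fin n) ℝ) (ε : ℝ)
    {s t : Setoid (Fin n)} (h : Refines s t) : Refines (refineF q ε s) (refineF q ε t) :=
  fun i j hij => ⟨hij.1.mono
    (fun a b hab => (fdeSum_le_of_refines q h a b).trans hab), h i j hij.2⟩

theorem isEpsFDE_iff_refineF_eq {n : ℕ} (q : Fin n → MvPolynomial (Fin n) ℝ) (ε : ℝ)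
    (H : Setoid (Fin n)) : IsEpsFDE q H ε ↔ refineF q ε H = H :=
  ⟨fun h => Setoid.ext fun i j => (h i j).symm,
    fun h i j => (Setoid.ext_iff.mp h i j).symm⟩

theorem Refines.card_quotient_lt {n : ℕ} {s t : Setoid (Fin n)} (h : Refines s t)
    (hne : s ≠ t) : Nat.card (Quotient t) < Nat.card (Quotient s) := by
  let f : Quotient s → Quotient t := Quotient.map' id h
  have hf : Function.Surjective f := by
    rintro ⟨a⟩
    exact ⟨Quotient.mk s a, rfl⟩
  refine lt_of_le_of_ne (Nat.card_le_card_of_surjective f hf) fun hcard => hne ?_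
  have hinj : Function.Injective f :=
    ((Nat.bijective_iff_surjective_and_card f).mpr ⟨hf, hcard.symm⟩).1
  refine h.antisymm fun i j hij => Quotient.exact (hinj ?_)
  exact Quotient.sound (s := t) hij

/-- for the partition-refinement iteration `H_0 = G`, `H_{k+1} = F(H_k)`
driven by the operator `F = refineF q ε`: every `H_{k+1}` refines `H_k`; the iteration
stabilizes after at most `n` steps; and the first fixed point is the unique coarsest
`ε`-FDE partition refining `G`. -/
theorem refineF_iteration {n : ℕ} (q : Fin n → MvPolynomial (Fin n) ℝ) (σ0 : Fin n → ℝ)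
    (G : Setoid (Fin n)) (ε : ℝ) (hε : 0 ≤ ε)
    (Hseq : ℕ → Setoid (Fin n)) (h0 : Hseq 0 = G)
    (hstep : ∀ k, Hseq (k + 1) = refineF q ε (Hseq k)) :
    (∀ k, Refines (Hseq (k + 1)) (Hseq k)) ∧
    (∃ k, k ≤ n ∧ refineF q ε (Hseq k) = Hseq k) ∧
    (∀ k, refineF q ε (Hseq k) = Hseq k →
      (∀ l, l < k → refineF q ε (Hseq l) ≠ Hseq l) →
      (IsEpsFDE q (Hseq k) ε ∧ Refines (Hseq k) G ∧
        (∀ H' : Setoid (Fin n), IsEpsFDE q H' ε → Refines H' G → Refines H' (Hseq k)) ∧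
        (∀ H'' : Setoid (Fin n), IsEpsFDE q H'' ε → Refines H'' G →
          (∀ H' : Setoid (Fin n), IsEpsFDE q H' ε → Refines H' G → Refines H' H'') →
          H'' = Hseq k))) := by
  have hrefines : ∀ k, Refines (Hseq (k + 1)) (Hseq k) := fun k => by
    rw [hstep]
    exact refineF_refines q ε _
  have hG : ∀ k, Refines (Hseq k) G := fun k => by
    induction k with
    | zero => exact h0 ▸ fun _ _ h => h
    | succ k ih => exact fun i j h => ih i j (hrefines k i j h)
  have hcoarse : ∀ H', IsEpsFDE q H' ε → Refines H' G → ∀ k, Refines H' (Hseq k) := by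
    intro H' hH' hH'G k
    induction k with
    | zero => exact h0 ▸ hH'G
    | succ k ih =>
      have h := refineF_mono q ε ih
      rwa [(isEpsFDE_iff_refineF_eq q ε H').mp hH', ← hstep] at h
  refine ⟨hrefines, ?_, fun k hk _ => ?_⟩
  · by_contra! hne
    have hcard : ∀ k, k ≤ n + 1 → k ≤ Nat.card (Quotient (Hseq k)) := fun k => by
      induction k with
      | zero => exact fun _ => Nat.zero_le _
      | succ k ih =>
        intro hk
        have hlt := (hrefines k).card_quotient_lt (hstep k ▸ hne k (by lia))
        exact (ih (by lia)).trans_lt hlt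
    have hle : Nat.card (Quotient (Hseq (n + 1))) ≤ Nat.card (Fin n) :=
      Nat.card_le_card_of_surjective _ Quotient.mk_surjective
    rw [Nat.card_fin] at hle
    have := hcard (n + 1) le_rfl
    lia
  · have hFDE := (isEpsFDE_iff_refineF_eq q ε _).mpr hk
    exact ⟨hFDE, hG k, fun H' h1 h2 => hcoarse H' h1 h2 k, fun H'' h1 h2 hmax =>
      (hcoarse H'' h1 h2 k).antisymm (hmax _ hFDE (hG k))⟩
end
end

section
/- Let τ̂ > 0, let q : ℝ^m → ℝ^m have multivariate polynomial components of total degree at most D, and let x* : [0,τ̂] → ℝ^m be a solution of ẋ = q(x). With A(t) = Dq(x*(t)), let Λ(t_0,t_1) be the state-transition matrices of ẏ = A(t)y, and set λ_0 = max_{0≤t≤τ̂} ‖Λ(0,t)‖ and λ_1 = max_{0≤t_0≤t_1≤τ̂} ‖Λ(t_0,t_1)‖. Let r(t,y) = q(x*(t)+y) − q(x*(t)) − A(t)y, and let d_2,…,d_D ≥ 0 be constants such that ‖r(t,y)‖ ≤ Σ_{k=2}^{D} d_k ‖y‖^k for all y ∈ ℝ^m and all t ∈ [0,τ̂]. Suppose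 δ > 0 satisfies Σ_{k=2}^{D} d_k (2λ_0 δ)^{k−1} ≤ (2 λ_1 τ̂)^{-1}. Then for every solution x_1 : [0,τ̂] → ℝ^m of ẋ = q(x), if ‖x_1(0) − x*(0)‖ ≤ δ then max_{0≤t≤τ̂} ‖x_1(t) − x*(t)‖ ≤ 2λ_0 ‖x_1(0) − x*(0)‖. -/
open MvPolynomial

section LinearPropagator

open Set Filter Topology

variable {E : Type*} [NormedAddCommGroup E] [NormedSpace ℝ E]

/-- `Λ` is the family of forward state-transition operators of `ẏ = A(t) y` on `[0, τ]`. -/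
def IsForwardPropagator (A : ℝ → E →L[ℝ] E) (Λ : ℝ → ℝ → E →L[ℝ] E) (τ : ℝ) : Prop :=
  ∀ t0 ∈ Icc (0 : ℝ) τ, ∀ y0 : E, ∃ y : ℝ → E, y t0 = y0 ∧
    (∀ t ∈ Icc t0 τ, HasDerivWithinAt y (A t (y t)) (Icc t0 τ) t) ∧
    ∀ t ∈ Icc t0 τ, y t = Λ t0 t y0

namespace IsForwardPropagator

variable {A : ℝ → E →L[ℝ] E} {Λ : ℝ → ℝ → E →L[ℝ] E} {τ : ℝ}

theorem self_apply (h : IsForwardPropagator A Λ τ) {s : ℝ} (hs : s ∈ Icc (0 : ℝ) τ) (v : E) :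
    Λ s s v = v := by
  obtain ⟨y, hy0, -, hy⟩ := h s hs v
  rw [← hy s ⟨le_rfl, hs.2⟩, hy0]

theorem hasDerivWithinAt (h : IsForwardPropagator A Λ τ) {s t : ℝ} (hs : s ∈ Icc (0 : ℝ) τ)
    (ht : t ∈ Icc s τ) (v : E) :
    HasDerivWithinAt (fun t => Λ s t v) (A t (Λ s t v)) (Icc s τ) t := by
  obtain ⟨y, -, hy', hy⟩ := h s hs v
  rw [← hy t ht]
  exact (hy' t ht).congr (fun x hx => (hy x hx).symm) (hy t ht).symm

theorem hasDerivWithinAt_Ici (h : IsForwardPropagator A Λ τ) {s t : ℝ} (hs : s ∈ Icc (0 : ℝ) τ)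
    (ht : t ∈ Ico s τ) (v : E) :
    HasDerivWithinAt (fun t => Λ s t v) (A t (Λ s t v)) (Ici t) t :=
  (h.hasDerivWithinAt hs (Ico_subset_Icc_self ht) v).mono_of_mem_nhdsWithin
    (Icc_mem_nhdsGE_of_mem ht)

/-- The cocycle identity for state-transition operators. -/
theorem comp_apply (h : IsForwardPropagator A Λ τ) {K : ℝ} (hK : ∀ t ∈ Icc (0 : ℝ) τ, ‖A t‖ ≤ K)
    {s s' t : ℝ} (hs : 0 ≤ s) (hss' : s ≤ s') (hst : s' ≤ t) (ht : t ≤ τ) (v : E) :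
    Λ s' t (Λ s s' v) = Λ s t v := by
  have hsm : s ∈ Icc (0 : ℝ) τ := ⟨hs, by linarith⟩
  have hsm' : s' ∈ Icc (0 : ℝ) τ := ⟨by linarith, by linarith⟩
  refine ODE_solution_unique_of_mem_Icc_right (v := fun t x => A t x) (s := fun _ => univ)
    (K := K.toNNReal) (a := s') (b := τ) (f := fun t => Λ s' t (Λ s s' v))
    (g := fun t => Λ s t v) (fun x hx => ?_) (fun x hx => ?_) (fun x hx => ?_)
    (fun _ _ => mem_univ _) (fun x hx => ?_) (fun x hx => ?_) (fun _ _ => mem_univ _) ?_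
    ⟨hst, ht⟩
  · refine ((A x).lipschitz.weaken ?_).lipschitzOnWith
    exact NNReal.le_toNNReal_of_coe_le (hK x ⟨hsm'.1.trans hx.1, hx.2.le⟩)
  · exact (h.hasDerivWithinAt hsm' hx _).continuousWithinAt
  · exact h.hasDerivWithinAt_Ici hsm' hx _
  · exact (h.hasDerivWithinAt hsm ⟨hss'.trans hx.1, hx.2⟩ v).continuousWithinAt.mono
      (Icc_subset_Icc_left hss')
  · exact h.hasDerivWithinAt_Ici hsm ⟨hss'.trans hx.1, hx.2⟩ v
  · exact h.self_apply hsm' _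

theorem norm_apply_sub_le (h : IsForwardPropagator A Λ τ) {K L : ℝ}
    (hK : ∀ t ∈ Icc (0 : ℝ) τ, ‖A t‖ ≤ K)
    (hL : ∀ s t, 0 ≤ s → s ≤ t → t ≤ τ → ‖Λ s t‖ ≤ L)
    {s t : ℝ} (hs : 0 ≤ s) (hst : s ≤ t) (ht : t ≤ τ) (v : E) :
    ‖Λ s t v - v‖ ≤ K * (L * ‖v‖) * (t - s) := by
  have hsm : s ∈ Icc (0 : ℝ) τ := ⟨hs, hst.trans ht⟩
  have := norm_image_sub_le_of_norm_deriv_le_segment' (f := fun t => Λ s t v)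
    (fun x hx => h.hasDerivWithinAt hsm hx v) (C := K * (L * ‖v‖)) (fun x hx => ?_) t ⟨hst, ht⟩
  · simpa only [h.self_apply hsm v] using this
  · exact (A x).le_of_opNorm_le_of_le (hK x ⟨hs.trans hx.1, hx.2.le⟩)
      ((Λ s x).le_of_opNorm_le (hL s x hs hx.1 hx.2.le) v)

theorem continuousOn_apply (h : IsForwardPropagator A Λ τ) {K L : ℝ}
    (hK : ∀ t ∈ Icc (0 : ℝ) τ, ‖A t‖ ≤ K)
    (hL : ∀ s t, 0 ≤ s → s ≤ t → t ≤ τ → ‖Λ s t‖ ≤ L)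
    {z : ℝ → E} (hz : ContinuousOn z (Icc 0 τ)) {t : ℝ} (ht : t ≤ τ) :
    ContinuousOn (fun s => Λ s t (z s)) (Icc 0 t) := by
  rcases lt_or_ge t 0 with ht0 | ht0
  · simp [Icc_eq_empty_of_lt ht0]
  have hL0 : 0 ≤ L := (norm_nonneg _).trans (hL 0 0 le_rfl le_rfl (ht0.trans ht))
  have hK0 : 0 ≤ K := (norm_nonneg _).trans (hK 0 ⟨le_rfl, ht0.trans ht⟩)
  obtain ⟨B, hB⟩ := isCompact_Icc.exists_bound_of_continuousOn hz
  have key : ∀ s s', 0 ≤ s → s ≤ s' → s' ≤ t →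
      ‖Λ s' t (z s') - Λ s t (z s)‖ ≤ L * (‖z s' - z s‖ + K * (L * B) * |s' - s|) := by
    intro s s' hs hss' hst
    rw [← h.comp_apply hK hs hss' hst ht, ← map_sub]
    refine (Λ s' t).le_of_opNorm_le_of_le (hL s' t (hs.trans hss') hst ht) ?_
    have h1 := h.norm_apply_sub_le hK hL hs hss' (hst.trans ht) (z s)
    have h2 : K * (L * ‖z s‖) * (s' - s) ≤ K * (L * B) * |s' - s| := by
      rw [abs_of_nonneg (sub_nonneg.2 hss')]
      have := hB s ⟨hs, by linarith⟩
      have := sub_nonneg.2 hss'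
      gcongr
    calc ‖z s' - Λ s s' (z s)‖ = ‖(z s' - z s) - (Λ s s' (z s) - z s)‖ := by congr 1; abel
      _ ≤ _ := (norm_sub_le _ _).trans (by linarith)
  have key' : ∀ s ∈ Icc 0 t, ∀ s' ∈ Icc 0 t,
      ‖Λ s' t (z s') - Λ s t (z s)‖ ≤ L * (‖z s' - z s‖ + K * (L * B) * |s' - s|) := by
    intro s hs s' hs'
    rcases le_total s s' with hle | hle
    · exact key s s' hs.1 hle hs'.2
    · have := key s' s hs'.1 hle hs.2
      rwa [norm_sub_rev, norm_sub_rev (z s), abs_sub_comm] at this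
  intro s hs
  have hzs : ContinuousWithinAt z (Icc 0 t) s :=
    (hz s ⟨hs.1, hs.2.trans ht⟩).mono (Icc_subset_Icc_right ht)
  rw [ContinuousWithinAt, tendsto_iff_norm_sub_tendsto_zero]
  refine squeeze_zero' (Eventually.of_forall fun _ => norm_nonneg _)
    (eventually_mem_nhdsWithin.mono fun s' hs' => key' s hs s' hs') ?_
  have hc : ContinuousWithinAt (fun s' => L * (‖z s' - z s‖ + K * (L * B) * |s' - s|))
      (Icc 0 t) s := by fun_prop
  simpa [ContinuousWithinAt] using hc

/-- A variation-of-constants estimate: a forcing term of norm at most `R` displaces the solution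
from the unforced one by at most `L * R * t`. -/
theorem norm_sub_apply_le (h : IsForwardPropagator A Λ τ) {K L R : ℝ}
    (hK : ∀ t ∈ Icc (0 : ℝ) τ, ‖A t‖ ≤ K)
    (hL : ∀ s t, 0 ≤ s → s ≤ t → t ≤ τ → ‖Λ s t‖ ≤ L)
    {z r : ℝ → E}
    (hz : ∀ t ∈ Icc (0 : ℝ) τ, HasDerivWithinAt z (A t (z t) + r t) (Icc 0 τ) t)
    {t : ℝ} (ht : t ∈ Icc (0 : ℝ) τ) (hR : ∀ s ∈ Ico 0 t, ‖r s‖ ≤ R) :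
    ‖z t - Λ 0 t (z 0)‖ ≤ L * R * t := by
  have hL0 : 0 ≤ L := (norm_nonneg _).trans (hL 0 0 le_rfl le_rfl (ht.1.trans ht.2))
  set g : ℝ → E := fun s => Λ s t (z s) with hg
  have hgc : ContinuousOn g (Icc 0 t) :=
    h.continuousOn_apply hK hL (fun s hs => (hz s hs).continuousWithinAt) ht.2
  have hgt : g t = z t := h.self_apply ht _
  rw [← hgt]
  refine image_le_of_liminf_slope_right_le_deriv_boundary (f := fun s => ‖g s - g 0‖)
    (B := fun s => L * R * s) (B' := fun _ => L * R) (a := 0) (b := t)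
    (by fun_prop) (by simp) (by fun_prop)
    (fun x _ => by simpa using ((hasDerivWithinAt_id x (Ici x)).const_mul (L * R)))
    (fun s hs ρ hρ => ?_) ⟨ht.1, le_rfl⟩
  have hsτ : s ∈ Ico 0 τ := ⟨hs.1, hs.2.trans_le ht.2⟩
  have hsm : s ∈ Icc 0 τ := Ico_subset_Icc_self hsτ
  have hu : HasDerivWithinAt (fun x => z x - Λ s x (z s)) (r s) (Ioi s) s := by
    have h1 := ((hz s hsm).mono_of_mem_nhdsWithin (Icc_mem_nhdsGE_of_mem hsτ)).sub
      (h.hasDerivWithinAt_Ici hsm ⟨le_rfl, hsτ.2⟩ (z s))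
    rw [h.self_apply hsm, add_sub_cancel_left] at h1
    exact h1.mono Ioi_subset_Ici_self
  rw [hasDerivWithinAt_iff_tendsto_slope' self_notMem_Ioi] at hu
  have hlt : L * ‖r s‖ < ρ := (mul_le_mul_of_nonneg_left (hR s hs) hL0).trans_lt hρ
  have hev := (hu.norm.const_mul L).eventually_lt_const hlt
  refine Eventually.frequently ?_
  filter_upwards [hev, Ioo_mem_nhdsGT hs.2] with x hx hxm
  refine lt_of_le_of_lt ?_ hx
  have hxs : 0 < x - s := sub_pos.2 hxm.1
  have h1 : ‖g x - g s‖ ≤ L * ‖z x - Λ s x (z s)‖ := by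
    simp only [hg]
    rw [← h.comp_apply hK hs.1 hxm.1.le hxm.2.le ht.2, ← map_sub]
    exact (Λ x t).le_of_opNorm_le (hL x t (hs.1.trans hxm.1.le) hxm.2.le ht.2) _
  have h2 : ‖g x - g 0‖ - ‖g s - g 0‖ ≤ ‖g x - g s‖ := by
    simpa using norm_sub_norm_le (g x - g 0) (g s - g 0)
  rw [slope_def_field, slope_def_module, h.self_apply hsm, sub_self, sub_zero, norm_smul,
    norm_inv, Real.norm_of_nonneg hxs.le, div_le_iff₀ hxs]
  calc _ ≤ L * ‖z x - Λ s x (z s)‖ := h2.trans h1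
    _ = _ := by field_simp

end IsForwardPropagator

end LinearPropagator

/-- Continuous induction: if `f` is at most `M` at every time before which it is below `M`, and
strictly so except possibly at the endpoint `τ`, then `f ≤ M` on `[0, τ]`. -/
theorem ContinuousOn.le_of_forall_lt_imp {f : ℝ → ℝ} {τ M : ℝ}
    (hf : ContinuousOn f (Set.Icc 0 τ))
    (hlt : ∀ t ∈ Set.Ico 0 τ, (∀ s ∈ Set.Ico 0 t, f s < M) → f t < M)
    (hle : (∀ s ∈ Set.Ico 0 τ, f s < M) → f τ ≤ M) :
    ∀ t ∈ Set.Icc 0 τ, f t ≤ M := by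
  intro t ht
  by_contra! hM
  have hc : IsCompact (Set.Icc 0 t ∩ f ⁻¹' Set.Ici M) :=
    isCompact_Icc.of_isClosed_subset
      ((hf.mono (Set.Icc_subset_Icc_right ht.2)).preimage_isClosed_of_isClosed
        isClosed_Icc isClosed_Ici) Set.inter_subset_left
  obtain ⟨s, ⟨hs, hsM⟩, hmin⟩ := hc.exists_isLeast ⟨t, ⟨ht.1, le_rfl⟩, hM.le⟩
  have hbefore : ∀ x ∈ Set.Ico 0 s, f x < M := fun x hx => by
    by_contra! hx'
    exact absurd (hmin ⟨⟨hx.1, hx.2.le.trans hs.2⟩, hx'⟩) (not_le.2 hx.2)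
  rcases (hs.2.trans ht.2).lt_or_eq with hsτ | hsτ
  · exact absurd (hlt s ⟨hs.1, hsτ⟩ hbefore) (not_lt.2 hsM)
  · obtain rfl : s = t := le_antisymm hs.2 (ht.2.trans hsτ.ge)
    subst hsτ
    exact absurd (hle hbefore) (not_le.2 hM)

theorem contDiff_of_eval_mvPolynomial {m : ℕ} (P : Fin m → MvPolynomial (Fin m) ℝ)
    {q : (Fin m → ℝ) → Fin m → ℝ} (hq : ∀ x i, q x i = eval x (P i)) : ContDiff ℝ 1 q := by
  refine contDiff_pi.2 fun i => ?_
  simp only [hq]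
  exact (AnalyticOnNhd.eval_mvPolynomial (P i)).contDiff

/-- error bound, Theorem 8 of the paper: let `q` be a polynomial vector
field of degree at most `D`, `x*` a reference solution of `ẋ = q(x)` on `[0,τ̂]`,
`A(t) = Dq(x*(t))` the Jacobian along the reference trajectory, `Λ` the associated family of
state-transition operators, `λ₀ = max ‖Λ(0,t)‖`, `λ₁ = max ‖Λ(t₀,t₁)‖`, and let
`d_2,…,d_D ≥ 0` bound the remainder `r(t,y) = q(x*(t)+y) − q(x*(t)) − A(t)y` via
`‖r(t,y)‖ ≤ Σ_{k=2}^D d_k ‖y‖^k`. If `δ > 0` satisfies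
`Σ_{k=2}^D d_k (2λ₀δ)^{k−1} ≤ (2λ₁τ̂)⁻¹`, then every solution `x₁` of `ẋ = q(x)` with
`‖x₁(0) − x*(0)‖ ≤ δ` satisfies `‖x₁(t) − x*(t)‖ ≤ 2λ₀‖x₁(0) − x*(0)‖` on `[0,τ̂]`.
All norms are sup-norms and induced operator norms. -/
theorem error_bound (m D : ℕ) (τ : ℝ) (hτ : 0 < τ)
    (P : Fin m → MvPolynomial (Fin m) ℝ) (hdeg : ∀ i, (P i).totalDegree ≤ D)
    (q : (Fin m → ℝ) → Fin m → ℝ) (hq : ∀ x i, q x i = eval x (P i))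
    (xs : ℝ → Fin m → ℝ)
    (hxs : ∀ t ∈ Set.Icc (0 : ℝ) τ, HasDerivWithinAt xs (q (xs t)) (Set.Icc 0 τ) t)
    (A : ℝ → (Fin m → ℝ) →L[ℝ] (Fin m → ℝ)) (hA : ∀ t, A t = fderiv ℝ q (xs t))
    (Λ : ℝ → ℝ → (Fin m → ℝ) →L[ℝ] (Fin m → ℝ))
    (hΛ : ∀ t0 ∈ Set.Icc (0 : ℝ) τ, ∀ y0 : Fin m → ℝ, ∃ y : ℝ → Fin m → ℝ, y t0 = y0 ∧
        (∀ t ∈ Set.Icc t0 τ, HasDerivWithinAt y (A t (y t)) (Set.Icc t0 τ) t) ∧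
        ∀ t ∈ Set.Icc t0 τ, y t = Λ t0 t y0)
    (lam0 lam1 : ℝ)
    (hlam0 : IsGreatest ((fun t => ‖Λ 0 t‖) '' Set.Icc (0 : ℝ) τ) lam0)
    (hlam1 : IsGreatest {r : ℝ | ∃ t0 t1 : ℝ, 0 ≤ t0 ∧ t0 ≤ t1 ∧ t1 ≤ τ ∧ r = ‖Λ t0 t1‖} lam1)
    (d : ℕ → ℝ) (hd : ∀ k ∈ Finset.Icc 2 D, 0 ≤ d k)
    (hr : ∀ t ∈ Set.Icc (0 : ℝ) τ, ∀ y : Fin m → ℝ,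
        ‖q (xs t + y) - q (xs t) - A t y‖ ≤ ∑ k ∈ Finset.Icc 2 D, d k * ‖y‖ ^ k)
    (δ : ℝ) (hδpos : 0 < δ)
    (hδ : ∑ k ∈ Finset.Icc 2 D, d k * (2 * lam0 * δ) ^ (k - 1) ≤ (2 * lam1 * τ)⁻¹)
    (x1 : ℝ → Fin m → ℝ)
    (hx1 : ∀ t ∈ Set.Icc (0 : ℝ) τ, HasDerivWithinAt x1 (q (x1 t)) (Set.Icc 0 τ) t)
    (hinit : ‖x1 0 - xs 0‖ ≤ δ) :
    ∀ t ∈ Set.Icc (0 : ℝ) τ, ‖x1 t - xs t‖ ≤ 2 * lam0 * ‖x1 0 - xs 0‖ := by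
  have hprop : IsForwardPropagator A Λ τ := hΛ
  have h0 : (0 : ℝ) ∈ Set.Icc 0 τ := ⟨le_rfl, hτ.le⟩
  have hxsc : ContinuousOn xs (Set.Icc 0 τ) := fun t ht => (hxs t ht).continuousWithinAt
  have hx1c : ContinuousOn x1 (Set.Icc 0 τ) := fun t ht => (hx1 t ht).continuousWithinAt
  have hAc : ContinuousOn A (Set.Icc 0 τ) := by
    rw [funext hA]
    exact ((contDiff_of_eval_mvPolynomial P hq).continuous_fderiv one_ne_zero).comp_continuousOn
      hxsc
  obtain ⟨K, hK⟩ := isCompact_Icc.exists_bound_of_continuousOn hAc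
  have hL : ∀ s t, 0 ≤ s → s ≤ t → t ≤ τ → ‖Λ s t‖ ≤ lam1 :=
    fun s t hs hst ht => hlam1.2 ⟨s, t, hs, hst, ht, rfl⟩
  have hL0 : ∀ t ∈ Set.Icc 0 τ, ‖Λ 0 t‖ ≤ lam0 := fun t ht => hlam0.2 ⟨t, ht, rfl⟩
  rcases subsingleton_or_nontrivial (Fin m → ℝ) with hsub | hnt
  · intro t _
    simp [Subsingleton.elim (x1 t) (xs t), Subsingleton.elim (x1 0) (xs 0)]
  have hid : ‖Λ 0 0‖ = 1 := by
    rw [show Λ 0 0 = ContinuousLinearMap.id ℝ _ from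
      ContinuousLinearMap.ext fun v => hprop.self_apply h0 v, ContinuousLinearMap.norm_id]
  have hlam0pos : 0 < lam0 := by linarith [hL0 0 h0]
  have hlam1pos : 0 < lam1 := by linarith [hL 0 0 le_rfl le_rfl hτ.le]
  set z : ℝ → Fin m → ℝ := fun t => x1 t - xs t with hz
  set r : ℝ → Fin m → ℝ := fun t => q (xs t + z t) - q (xs t) - A t (z t) with hrdef
  have hzd : ∀ t ∈ Set.Icc (0 : ℝ) τ,
      HasDerivWithinAt z (A t (z t) + r t) (Set.Icc 0 τ) t := fun t ht => by
    have hder : A t (z t) + r t = q (x1 t) - q (xs t) := by simp [hrdef, hz]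
    rw [hder]
    exact (hx1 t ht).sub (hxs t ht)
  have hbound : ∀ a, 0 < a → a ≤ δ → ‖z 0‖ ≤ a →
      ∀ t ∈ Set.Icc (0 : ℝ) τ, ‖z t‖ ≤ 2 * lam0 * a := by
    intro a ha haδ hza
    have hM : 0 < 2 * lam0 * a := by positivity
    have step : ∀ t ∈ Set.Icc 0 τ, (∀ s ∈ Set.Ico 0 t, ‖z s‖ < 2 * lam0 * a) →
        ‖z t‖ ≤ lam0 * a + lam0 * a * (t / τ) := by
      intro t ht hs
      have hR : ∀ s ∈ Set.Ico 0 t, ‖r s‖ ≤ 2 * lam0 * a * (2 * lam1 * τ)⁻¹ := by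
        intro s hst
        refine (hr s ⟨hst.1, hst.2.le.trans ht.2⟩ (z s)).trans ?_
        refine le_trans ?_ (mul_le_mul_of_nonneg_left hδ hM.le)
        rw [Finset.mul_sum]
        refine Finset.sum_le_sum fun k hk => ?_
        obtain ⟨n, rfl⟩ : ∃ n, k = n + 1 := ⟨k - 1, by grind⟩
        have hdk := hd _ hk
        have hzs := (hs s hst).le
        calc d (n + 1) * ‖z s‖ ^ (n + 1) = d (n + 1) * (‖z s‖ * ‖z s‖ ^ n) := by ring
          _ ≤ d (n + 1) * (2 * lam0 * a * (2 * lam0 * δ) ^ n) := by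
            gcongr
            exact hzs.trans (by gcongr)
          _ = _ := by simp only [Nat.add_sub_cancel]; ring
      have h1 := hprop.norm_sub_apply_le hK hL hzd ht hR
      have h2 : ‖Λ 0 t (z 0)‖ ≤ lam0 * a := (Λ 0 t).le_of_opNorm_le_of_le (hL0 t ht) hza
      have h3 : lam1 * (2 * lam0 * a * (2 * lam1 * τ)⁻¹) * t = lam0 * a * (t / τ) := by
        field_simp
      have h4 := norm_le_norm_add_norm_sub' (z t) (Λ 0 t (z 0))
      linarith
    have hla : 0 < lam0 * a := by positivity
    refine ContinuousOn.le_of_forall_lt_imp (hx1c.sub hxsc).norm (fun t ht hs => ?_)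
      (fun hs => ?_)
    · have h1 := step t (Set.Ico_subset_Icc_self ht) hs
      have h2 : t / τ < 1 := (div_lt_one hτ).2 ht.2
      change ‖z t‖ < _
      nlinarith
    · have h1 := step τ ⟨hτ.le, le_rfl⟩ hs
      rw [div_self hτ.ne'] at h1
      change ‖z τ‖ ≤ _
      linarith
  intro t ht
  change ‖z t‖ ≤ 2 * lam0 * ‖z 0‖
  rcases (norm_nonneg (z 0)).eq_or_lt with hz0 | hz0
  · rw [← hz0, mul_zero]
    refine le_of_forall_pos_le_add fun ε hε => ?_
    have h1 := hbound (min δ (ε / (2 * lam0))) (by positivity) (min_le_left _ _)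
      (by rw [← hz0]; positivity) t ht
    have h2 : 2 * lam0 * min δ (ε / (2 * lam0)) ≤ 2 * lam0 * (ε / (2 * lam0)) := by
      gcongr
      exact min_le_right _ _
    rw [mul_div_cancel₀ _ (by positivity)] at h2
    linarith
  · exact hbound _ hz0 hinit le_rfl t ht
end

section
/- Let τ̂ > 0, let A : [0,τ̂] → ℝ^{m×m} be continuous with ‖A(t)‖ ≤ L for all t ∈ [0,τ̂], and let Λ(t_0,t_1) be the state-transition matrices of ẏ = A(t)y. Fix a discretization step Δt > 0 with grid points t_i = iΔt, i = 0,…,K, where t_K = τ̂. Set λ_0 = max_{0≤t≤τ̂} ‖Λ(0,t)‖, λ_1 = max_{0≤t_0≤t_1≤τ̂} ‖Λ(t_0,t_1)‖, λ_0^+ = max_{0≤i≤K} ‖Λ(0,t_i)‖ and λ_1^+ = max_{0≤i≤j≤K} ‖Λ(t_i,t_j)‖. Then λ_0 ≤ λ_0^+ e^{LΔt} and λ_1 ≤ λ_1^+ [1 + LΔt (e^{LΔt} + 1)]. -/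
/-- Grönwall's inequality, forward in time. -/
theorem norm_right_le_exp_mul_norm_left {E : Type*} [NormedAddCommGroup E] [NormedSpace ℝ E]
    {f f' : ℝ → E} {a b L : ℝ} (hab : a ≤ b)
    (hf : ∀ t ∈ Set.Icc a b, HasDerivWithinAt f (f' t) (Set.Icc a b) t)
    (hf' : ∀ t ∈ Set.Icc a b, ‖f' t‖ ≤ L * ‖f t‖) :
    ‖f b‖ ≤ Real.exp (L * (b - a)) * ‖f a‖ := by
  have h := norm_le_gronwallBound_of_norm_deriv_right_le (f := f) (f' := f') (δ := ‖f a‖)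
    (K := L) (ε := 0) (a := a) (b := b) (fun t ht => (hf t ht).continuousWithinAt)
    (fun t ht => (hf t ⟨ht.1, ht.2.le⟩).mono_of_mem_nhdsWithin
      (Icc_mem_nhdsGE_of_mem ht)) le_rfl
    (fun t ht => by simpa using hf' t ⟨ht.1, ht.2.le⟩) b ⟨hab, le_rfl⟩
  rw [gronwallBound_ε0] at h
  linarith

/-- Grönwall's inequality, backward in time. -/
theorem norm_left_le_exp_mul_norm_right {E : Type*} [NormedAddCommGroup E] [NormedSpace ℝ E]
    {f f' : ℝ → E} {a b L : ℝ} (hab : a ≤ b)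
    (hf : ∀ t ∈ Set.Icc a b, HasDerivWithinAt f (f' t) (Set.Icc a b) t)
    (hf' : ∀ t ∈ Set.Icc a b, ‖f' t‖ ≤ L * ‖f t‖) :
    ‖f a‖ ≤ Real.exp (L * (b - a)) * ‖f b‖ := by
  have hmaps : ∀ t ∈ Set.Icc a b, a + b - t ∈ Set.Icc a b := fun t ht =>
    ⟨by linarith [ht.2], by linarith [ht.1]⟩
  have h := norm_right_le_exp_mul_norm_left (f := fun t => f (a + b - t))
    (f' := fun t => -f' (a + b - t)) (L := L) hab
    (fun t ht => by
      have hd : HasDerivWithinAt (fun t : ℝ => a + b - t) (-1) (Set.Icc a b) t :=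
        (hasDerivWithinAt_id t _).const_sub (a + b)
      simpa [Function.comp_def] using (hf _ (hmaps t ht)).scomp t hd hmaps)
    (fun t ht => by simpa using hf' _ (hmaps t ht))
  simpa using h

/-- Comparison of a transition operator between arbitrary times with one between nearby times,
given that the trajectories starting at time `0` obey the cocycle law and change norm at most
exponentially, with rate `L`, in both time directions. -/
theorem norm_transition_le {E : Type*} [NormedAddCommGroup E] [NormedSpace ℝ E]
    [FiniteDimensional ℝ E] {τ L : ℝ} (hτ : 0 ≤ τ) {Λ : ℝ → ℝ → E →L[ℝ] E}
    (hinit : ∀ x, Λ 0 0 x = x)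
    (hcocycle : ∀ s t, 0 ≤ s → s ≤ t → t ≤ τ → ∀ x, Λ s t (Λ 0 s x) = Λ 0 t x)
    (hgrowth : ∀ s ∈ Set.Icc 0 τ, ∀ t ∈ Set.Icc 0 τ, ∀ x,
      ‖Λ 0 t x‖ ≤ Real.exp (L * |t - s|) * ‖Λ 0 s x‖)
    {t₀ t₁ s₀ s₁ : ℝ} (ht₀ : 0 ≤ t₀) (ht : t₀ ≤ t₁) (ht₁ : t₁ ≤ τ)
    (hs₀ : 0 ≤ s₀) (hs : s₀ ≤ s₁) (hs₁ : s₁ ≤ τ) :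
    ‖Λ t₀ t₁‖ ≤ ‖Λ s₀ s₁‖ * Real.exp (L * (|t₀ - s₀| + |t₁ - s₁|)) := by
  have hsurj : Function.Surjective (Λ 0 t₀) := by
    have hinj : Function.Injective (Λ 0 t₀ : E →ₗ[ℝ] E) := by
      refine (injective_iff_map_eq_zero _).2 fun x hx => ?_
      have hx' : Λ 0 t₀ x = 0 := hx
      have h := hgrowth t₀ ⟨ht₀, ht.trans ht₁⟩ 0 ⟨le_rfl, hτ⟩ x
      rw [hinit, hx', norm_zero, mul_zero] at h
      exact norm_le_zero_iff.1 h
    exact LinearMap.injective_iff_surjective.1 hinj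
  refine ContinuousLinearMap.opNorm_le_bound _ (by positivity) fun y => ?_
  obtain ⟨x, rfl⟩ := hsurj y
  rw [hcocycle t₀ t₁ ht₀ ht ht₁]
  calc ‖Λ 0 t₁ x‖
      ≤ Real.exp (L * |t₁ - s₁|) * ‖Λ s₀ s₁ (Λ 0 s₀ x)‖ := by
        rw [hcocycle s₀ s₁ hs₀ hs hs₁]
        exact hgrowth s₁ ⟨hs₀.trans hs, hs₁⟩ t₁ ⟨ht₀.trans ht, ht₁⟩ x
    _ ≤ Real.exp (L * |t₁ - s₁|) *
          (‖Λ s₀ s₁‖ * (Real.exp (L * |s₀ - t₀|) * ‖Λ 0 t₀ x‖)) := by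
        gcongr
        exact (Λ s₀ s₁).le_opNorm_of_le
          (hgrowth t₀ ⟨ht₀, ht.trans ht₁⟩ s₀ ⟨hs₀, hs.trans hs₁⟩ x)
    _ = ‖Λ s₀ s₁‖ * Real.exp (L * (|t₀ - s₀| + |t₁ - s₁|)) * ‖Λ 0 t₀ x‖ := by
        rw [mul_add, Real.exp_add, abs_sub_comm s₀ t₀]
        ring

/-- Rounding to the nearest multiple of `δ` is off by at most `δ / 2`. -/
theorem abs_sub_natFloor_mul_le {δ t : ℝ} (hδ : 0 < δ) (ht : 0 ≤ t) :
    |t - (⌊t / δ + 1 / 2⌋₊ : ℝ) * δ| ≤ δ / 2 := by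
  have h₁ := Nat.floor_le (a := t / δ + 1 / 2) (by positivity)
  have h₂ := Nat.lt_floor_add_one (t / δ + 1 / 2)
  have h₃ : t = t / δ * δ := by field_simp
  rw [abs_le]
  constructor <;> nlinarith

/-- Lemma 3 of the paper: let `A : [0,τ̂] → ℝ^{m×m}` be continuous with
`‖A(t)‖ ≤ L`, `Λ` the state-transition operators of `ẏ = A(t)y`, and fix a grid
`t_i = iΔt`, `i = 0,…,K`, with `t_K = τ̂`. With `λ₀ = max_{0≤t≤τ̂} ‖Λ(0,t)‖`,
`λ₁ = max_{0≤t₀≤t₁≤τ̂} ‖Λ(t₀,t₁)‖`, `λ₀⁺ = max_i ‖Λ(0,t_i)‖` and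
`λ₁⁺ = max_{i≤j} ‖Λ(t_i,t_j)‖`, it holds that `λ₀ ≤ λ₀⁺ e^{LΔt}` and
`λ₁ ≤ λ₁⁺ (1 + LΔt(e^{LΔt} + 1))`. Norms are sup-norms and induced operator norms. -/
theorem lambda_discretization_bound (m : ℕ) (τ L Δt : ℝ) (hτ : 0 < τ) (hΔt : 0 < Δt)
    (K : ℕ) (hK : (K : ℝ) * Δt = τ)
    (A : ℝ → (Fin m → ℝ) →L[ℝ] (Fin m → ℝ)) (hA : ContinuousOn A (Set.Icc 0 τ))
    (hL : ∀ t ∈ Set.Icc (0 : ℝ) τ, ‖A t‖ ≤ L)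
    (Λ : ℝ → ℝ → (Fin m → ℝ) →L[ℝ] (Fin m → ℝ))
    (hΛ : ∀ t0 ∈ Set.Icc (0 : ℝ) τ, ∀ y0 : Fin m → ℝ, ∃ y : ℝ → Fin m → ℝ, y t0 = y0 ∧
        (∀ t ∈ Set.Icc t0 τ, HasDerivWithinAt y (A t (y t)) (Set.Icc t0 τ) t) ∧
        ∀ t ∈ Set.Icc t0 τ, y t = Λ t0 t y0)
    (lam0 lam1 lam0p lam1p : ℝ)
    (hlam0 : IsGreatest ((fun t => ‖Λ 0 t‖) '' Set.Icc (0 : ℝ) τ) lam0)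
    (hlam1 : IsGreatest
      {r : ℝ | ∃ t0 t1 : ℝ, 0 ≤ t0 ∧ t0 ≤ t1 ∧ t1 ≤ τ ∧ r = ‖Λ t0 t1‖} lam1)
    (hlam0p : IsGreatest {r : ℝ | ∃ i : ℕ, i ≤ K ∧ r = ‖Λ 0 ((i : ℝ) * Δt)‖} lam0p)
    (hlam1p : IsGreatest
      {r : ℝ | ∃ i j : ℕ, i ≤ j ∧ j ≤ K ∧ r = ‖Λ ((i : ℝ) * Δt) ((j : ℝ) * Δt)‖} lam1p) :
    lam0 ≤ lam0p * Real.exp (L * Δt) ∧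
      lam1 ≤ lam1p * (1 + L * Δt * (Real.exp (L * Δt) + 1)) := by
  have hL0 : 0 ≤ L := (norm_nonneg _).trans (hL 0 ⟨le_rfl, hτ.le⟩)
  have hinit : ∀ x, Λ 0 0 x = x := fun x => by
    obtain ⟨y, hy0, -, hy⟩ := hΛ 0 ⟨le_rfl, hτ.le⟩ x
    rw [← hy 0 ⟨le_rfl, hτ.le⟩, hy0]
  have hbound : ∀ t ∈ Set.Icc (0 : ℝ) τ, ∀ v, ‖A t v‖ ≤ L * ‖v‖ := fun t ht v =>
    (A t).le_of_opNorm_le (hL t ht) v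
  have hcocycle : ∀ s t, 0 ≤ s → s ≤ t → t ≤ τ → ∀ x, Λ s t (Λ 0 s x) = Λ 0 t x := by
    intro s t hs hst ht x
    obtain ⟨y, -, hyd, hy⟩ := hΛ 0 ⟨le_rfl, hτ.le⟩ x
    obtain ⟨z, hz0, hzd, hz⟩ := hΛ s ⟨hs, hst.trans ht⟩ (Λ 0 s x)
    have h := norm_right_le_exp_mul_norm_left (f := fun r => z r - y r)
      (f' := fun r => A r (z r) - A r (y r)) (L := L) hst
      (fun r hr => ((hzd r ⟨hr.1, hr.2.trans ht⟩).mono (Set.Icc_subset_Icc_right ht)).sub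
        ((hyd r ⟨hs.trans hr.1, hr.2.trans ht⟩).mono (Set.Icc_subset_Icc hs ht)))
      (fun r hr => by
        rw [← map_sub]
        exact hbound r ⟨hs.trans hr.1, hr.2.trans ht⟩ _)
    rw [hz0, hy s ⟨hs, hst.trans ht⟩, sub_self, norm_zero, mul_zero, hz t ⟨hst, ht⟩,
      hy t ⟨hs.trans hst, ht⟩] at h
    exact sub_eq_zero.1 (norm_le_zero_iff.1 h)
  have hgrowth : ∀ s ∈ Set.Icc 0 τ, ∀ t ∈ Set.Icc 0 τ, ∀ x,
      ‖Λ 0 t x‖ ≤ Real.exp (L * |t - s|) * ‖Λ 0 s x‖ := by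
    intro s hs t ht x
    obtain ⟨y, -, hyd, hy⟩ := hΛ 0 ⟨le_rfl, hτ.le⟩ x
    rw [← hy s hs, ← hy t ht]
    rcases le_total s t with hst | hts
    · rw [abs_of_nonneg (sub_nonneg.2 hst)]
      have hsub : Set.Icc s t ⊆ Set.Icc 0 τ := Set.Icc_subset_Icc hs.1 ht.2
      exact norm_right_le_exp_mul_norm_left hst (fun r hr => (hyd r (hsub hr)).mono hsub)
        (fun r hr => hbound r (hsub hr) _)
    · rw [abs_sub_comm, abs_of_nonneg (sub_nonneg.2 hts)]
      have hsub : Set.Icc t s ⊆ Set.Icc 0 τ := Set.Icc_subset_Icc ht.1 hs.2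
      exact norm_left_le_exp_mul_norm_right hts (fun r hr => (hyd r (hsub hr)).mono hsub)
        (fun r hr => hbound r (hsub hr) _)
  let n : ℝ → ℕ := fun t => ⌊t / Δt + 1 / 2⌋₊
  have hnear : ∀ t, 0 ≤ t → |t - n t * Δt| ≤ Δt / 2 := fun t ht =>
    abs_sub_natFloor_mul_le hΔt ht
  have hnmono : ∀ s t, s ≤ t → n s ≤ n t := fun s t hst => Nat.floor_le_floor (by gcongr)
  have hnK : ∀ t, t ≤ τ → n t ≤ K := fun t ht => by
    have h : t / Δt ≤ K := by rwa [div_le_iff₀ hΔt, hK]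
    exact Nat.lt_succ_iff.1 ((Nat.floor_lt' (Nat.succ_ne_zero K)).2 (by push_cast; linarith))
  have hgrid : ∀ i : ℕ, i ≤ K → (i : ℝ) * Δt ≤ τ := fun i hi => by
    rw [← hK]
    gcongr
  constructor
  · obtain ⟨t, ht, rfl⟩ := hlam0.1
    have hmem : ‖Λ 0 (n t * Δt)‖ ≤ lam0p := hlam0p.2 ⟨n t, hnK t ht.2, rfl⟩
    have h := hnear t ht.1
    calc ‖Λ 0 t‖ ≤ ‖Λ 0 (n t * Δt)‖ * Real.exp (L * (|0 - 0| + |t - n t * Δt|)) :=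
          norm_transition_le hτ.le hinit hcocycle hgrowth le_rfl ht.1 ht.2 le_rfl (by positivity)
            (hgrid _ (hnK t ht.2))
      _ ≤ lam0p * Real.exp (L * Δt) := by
          gcongr
          · exact (norm_nonneg _).trans hmem
          · rw [sub_self, abs_zero]
            linarith
  · obtain ⟨t₀, t₁, ht₀, ht, ht₁, rfl⟩ := hlam1.1
    have hn := hnmono t₀ t₁ ht
    have hmem : ‖Λ (n t₀ * Δt) (n t₁ * Δt)‖ ≤ lam1p :=
      hlam1p.2 ⟨n t₀, n t₁, hn, hnK t₁ ht₁, rfl⟩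
    have hlam1p0 : 0 ≤ lam1p := (norm_nonneg _).trans hmem
    have h₀ := hnear t₀ ht₀
    have h₁ := hnear t₁ (ht₀.trans ht)
    calc ‖Λ t₀ t₁‖
        ≤ ‖Λ (n t₀ * Δt) (n t₁ * Δt)‖ *
            Real.exp (L * (|t₀ - n t₀ * Δt| + |t₁ - n t₁ * Δt|)) :=
          norm_transition_le hτ.le hinit hcocycle hgrowth ht₀ ht ht₁ (by positivity)
            (by gcongr) (hgrid _ (hnK t₁ ht₁))
      _ ≤ lam1p * Real.exp (L * Δt) := by
          gcongr
          linarith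
      _ ≤ lam1p * (1 + L * Δt * (Real.exp (L * Δt) + 1)) := by
          gcongr
          have hexp := Real.add_one_le_exp (-(L * Δt))
          have hmul : Real.exp (-(L * Δt)) * Real.exp (L * Δt) = 1 := by
            rw [← Real.exp_add, neg_add_cancel, Real.exp_zero]
          nlinarith [mul_nonneg hL0 hΔt.le, Real.exp_pos (L * Δt)]
end

section
/- Let ẋ_i = q_i(x_1,…,x_n), 1 ≤ i ≤ n, be a polynomial ODE system and let H be a 0-BDE partition (an exact BDE), i.e., for all x_i ∼_H x_j every coefficient of the substituted difference polynomial π_H(q_i − q_j) is zero. Let x : [0,T] → ℝ^n be a solution whose initial condition is constant on the blocks of H, i.e., x_i(0) = x_j(0) whenever x_i ∼_H x_j. Then x_i(t) = x_j(t) for all t ∈ [0,T] and all pairs x_i ∼_H x_j. -/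
open MvPolynomial

noncomputable section

theorem ptrep_eq {n : ℕ} {H : Setoid (Fin n)} {i j : Fin n} (h : H.r i j) :
    ptrep H i = ptrep H j :=
  congrArg Quotient.out (Quotient.sound h)

theorem rel_ptrep {n : ℕ} (H : Setoid (Fin n)) (i : Fin n) : H.r i (ptrep H i) :=
  H.symm (Quotient.mk_out i)

/-- Polynomials with the same image under `rename f` agree at points that factor through `f`. -/
theorem eval_comp_eq_of_rename_sub_eq_zero {σ τ R : Type*} [CommRing R] {f : σ → τ}
    {p q : MvPolynomial σ R} (h : rename f (p - q) = 0) (v : τ → R) :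
    eval (v ∘ f) p = eval (v ∘ f) q := by
  rw [← sub_eq_zero, ← map_sub, ← eval_rename, h, map_zero]

/-- A polynomial vector field is Lipschitz on every compact set. -/
theorem exists_lipschitzOnWith_eval {ι σ : Type*} [Fintype ι] [Fintype σ]
    (q : ι → MvPolynomial σ ℝ) {s : Set (σ → ℝ)} (hs : IsCompact s) :
    ∃ K, LipschitzOnWith K (fun v i => eval v (q i)) s := by
  have hq : ContDiff ℝ 1 (fun (v : σ → ℝ) i => eval v (q i)) :=
    contDiff_pi.2 fun i => (AnalyticOnNhd.eval_mvPolynomial (q i)).contDiff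
  exact hq.locallyLipschitz.locallyLipschitzOn.exists_lipschitzOnWith_of_compact hs

/-- if `H` is an exact BDE (0-BDE) partition of the polynomial ODE system
`ẋ_i = q_i(x)`, i.e. all coefficients of the substituted difference polynomial
`π_H (q_i − q_j)` vanish for all `x_i ∼_H x_j`, then any solution on `[0,T]` whose initial
condition is constant on the blocks of `H` remains constant on the blocks of `H` at all
times. -/
theorem exact_BDE_preserves_equality {n : ℕ} (q : Fin n → MvPolynomial (Fin n) ℝ)
    (H : Setoid (Fin n))
    (hbde : ∀ i j : Fin n, H.r i j →
      ∀ α : Fin n →₀ ℕ, coeff α (rename (ptrep H) (q i - q j)) = 0)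
    (T : ℝ) (hT : 0 ≤ T) (x : ℝ → Fin n → ℝ)
    (hsol : ∀ t ∈ Set.Icc (0 : ℝ) T,
      HasDerivWithinAt x (fun i => eval (x t) (q i)) (Set.Icc 0 T) t)
    (hinit : ∀ i j : Fin n, H.r i j → x 0 i = x 0 j) :
    ∀ t ∈ Set.Icc (0 : ℝ) T, ∀ i j : Fin n, H.r i j → x t i = x t j := by
  set r := ptrep H
  set F : (Fin n → ℝ) → Fin n → ℝ := fun v i => eval v (q i)
  have hx : ContinuousOn x (Set.Icc 0 T) := fun t ht => (hsol t ht).continuousWithinAt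
  have hr : Continuous fun v : Fin n → ℝ => v ∘ r :=
    continuous_pi fun i => continuous_apply (r i)
  obtain ⟨K, hK⟩ := exists_lipschitzOnWith_eval q
    ((isCompact_Icc.image_of_continuousOn hx).union
      (isCompact_Icc.image_of_continuousOn (hr.comp_continuousOn hx)))
  have hF (v : Fin n → ℝ) : F (v ∘ r) ∘ r = F (v ∘ r) := by
    funext i
    exact (eval_comp_eq_of_rename_sub_eq_zero
      (MvPolynomial.ext _ _ fun α => by simpa using hbde i (r i) (rel_ptrep H i) α) v).symm
  have hderiv : ∀ t ∈ Set.Icc (0 : ℝ) T,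
      HasDerivWithinAt (fun t => x t - x t ∘ r) (F (x t) - F (x t) ∘ r) (Set.Icc 0 T) t := by
    intro t ht
    have h := hasDerivWithinAt_pi.1 (hsol t ht)
    exact (hsol t ht).sub (hasDerivWithinAt_pi.2 fun i => h (r i))
  have hnorm (v : Fin n → ℝ) : ‖v ∘ r‖ ≤ ‖v‖ :=
    (pi_norm_le_iff_of_nonneg (norm_nonneg v)).2 fun i => norm_le_pi_norm v (r i)
  have hzero : ∀ t ∈ Set.Icc (0 : ℝ) T, x t - x t ∘ r = 0 := by
    refine eq_zero_of_abs_deriv_le_mul_abs_self_of_eq_zero_right (K := 2 * K)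
      (fun t ht => (hderiv t ht).continuousWithinAt)
      (fun t ht => (hderiv t (Set.Ico_subset_Icc_self ht)).mono_of_mem_nhdsWithin
        (Icc_mem_nhdsGE_of_mem ht))
      (funext fun i => sub_eq_zero.2 (hinit i (r i) (rel_ptrep H i))) fun t ht => ?_
    have ht' := Set.Ico_subset_Icc_self ht
    have hlip : ‖F (x t) - F (x t ∘ r)‖ ≤ K * ‖x t - x t ∘ r‖ :=
      hK.norm_sub_le (Or.inl ⟨t, ht', rfl⟩) (Or.inr ⟨t, ht', rfl⟩)
    have hsplit : F (x t) - F (x t) ∘ r =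
        (F (x t) - F (x t ∘ r)) - (F (x t) - F (x t ∘ r)) ∘ r := by
      have hcomp : (F (x t) - F (x t ∘ r)) ∘ r = F (x t) ∘ r - F (x t ∘ r) ∘ r := rfl
      rw [hcomp, hF]
      abel
    rw [hsplit]
    linarith [norm_sub_le (F (x t) - F (x t ∘ r)) ((F (x t) - F (x t ∘ r)) ∘ r),
      hnorm (F (x t) - F (x t ∘ r))]
  intro t ht i j hij
  have h (k : Fin n) : x t k = x t (r k) := sub_eq_zero.1 (congrFun (hzero t ht) k)
  rw [h i, h j, show r i = r j from ptrep_eq hij]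
end
end
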